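/- If the type inference algorithm succeeds with T(M) = (Γ, σ), x occurs free in M, and the variable y does not occur in M, then T(M[y/x]) = (Γ[y/x], σ), where Γ[y/x] renames the declared variable x to y in the environment (types are considered equal up to renaming of type variables). -/

import Mathlib

/-! ## λ-terms -/

inductive Term : Type
  | var : ℕ → Term
  | lam : ℕ → Term → Term
  | app : Term → Term → Term

namespace Term

/-- free variables -/
def fv : Term → Finset ℕ
  | .var x => {x}
  | .lam x M => fv M \ {x}
  | .app M N => fv M ∪ fv N

/-- all variables occurring in a term (free, bound or binding) -/
def allVars : Term → Finset ℕ
  | .var x => {x}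
  | .lam x M => insert x (allVars M)
  | .app M N => allVars M ∪ allVars N

/-- substitution `M[N/x]` (as in the paper, under the variable convention) -/
def subst : Term → ℕ → Term → Term
  | .var y, x, N => if y = x then N else .var y
  | .lam y M, x, N => if y = x then .lam y M else .lam y (subst M x N)
  | .app M₁ M₂, x, N => .app (subst M₁ x N) (subst M₂ x N)

/-- simultaneous renaming `M[y₁/x₁, …, yₙ/xₙ]` (the `yᵢ` being fresh) -/
def renList (M : Term) (xs ys : List ℕ) : Term :=
  (xs.zip ys).foldl (fun N q => N.subst q.1 (.var q.2)) M

/-- `M` is an abstraction -/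
def IsAbs (M : Term) : Prop := ∃ x N, M = lam x N

end Term

/-! ## Linear types and linear rank 2 intersection types -/

/-- linear types (linear rank 0 intersection types) -/
inductive LTy : Type
  | var : ℕ → LTy
  | lolly : LTy → LTy → LTy

/-- type variables of a linear type -/
def LTy.tv : LTy → Finset ℕ
  | .var α => {α}
  | .lolly a b => a.tv ∪ b.tv

/-- linear rank 2 intersection types: `σ ::= τ | τ ⊸ σ | (τ₁ ∩ ⋯ ∩ τₙ) → σ`.
Sequences (linear rank 1 types) are multisets of linear types (`∩` is associative,
commutative and non-idempotent); the constraint `n ≥ 2` on `arrow` is enforced in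
the typing rules. -/
inductive Ty2 : Type
  | lin : LTy → Ty2
  | lolly : LTy → Ty2 → Ty2
  | arrow : Multiset LTy → Ty2 → Ty2

/-- `τ ⊸ σ`: identifies `τ ⊸ τ'` (for `τ'` linear) with the linear type `τ ⊸ τ'`,
so that every rank 2 type has a unique representation. -/
def Ty2.mkLolly (τ : LTy) : Ty2 → Ty2
  | .lin τ' => .lin (.lolly τ τ')
  | σ => .lolly τ σ

/-- type variables of a rank 2 type -/
def Ty2.tv : Ty2 → Finset ℕ
  | .lin τ => τ.tv
  | .lolly τ σ => τ.tv ∪ σ.tv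
  | .arrow A σ => (A.map LTy.tv).sup ∪ σ.tv

/-- type substitutions (mapping type variables to linear types) -/
abbrev TSub := ℕ → LTy

def LTy.applyS (S : TSub) : LTy → LTy
  | .var α => S α
  | .lolly a b => .lolly (a.applyS S) (b.applyS S)

def Ty2.applyS (S : TSub) : Ty2 → Ty2
  | .lin τ => .lin (τ.applyS S)
  | .lolly τ σ => .lolly (τ.applyS S) (σ.applyS S)
  | .arrow A σ => .arrow (A.map (LTy.applyS S)) (σ.applyS S)

/-! ## Environments -/

section GEnv
variable {β : Type}

/-- the domain of an environment -/
def domG (Γ : List (ℕ × β)) : List ℕ := Γ.map Prod.fst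

/-- a finite list of declarations is consistent iff the term variables are distinct -/
def consistentG (Γ : List (ℕ × β)) : Prop := (Γ.map Prod.fst).Nodup

/-- the predicate declared for `x` (defaulting to `0`, i.e. empty) -/
def lookupG [Zero β] (Γ : List (ℕ × β)) (x : ℕ) : β :=
  ((Γ.find? (fun p => p.1 == x)).map Prod.snd).getD 0

/-- `Γ₁ + Γ₂`: merge two environments, intersecting the predicates of common
variables; declarations of `Γ₁` come first, in order, followed by the
declarations of variables only in `Γ₂`, in order. -/
def addG [Zero β] [Add β] (Γ₁ Γ₂ : List (ℕ × β)) : List (ℕ × β) :=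
  Γ₁.map (fun p => (p.1, p.2 + lookupG Γ₂ p.1)) ++
    Γ₂.filter (fun p => !((Γ₁.map Prod.fst).contains p.1))

/-- `Σᵢ Γᵢ` -/
def sumG [Zero β] [Add β] (l : List (List (ℕ × β))) : List (ℕ × β) :=
  l.foldr addG []

/-- `Γ_x` : remove the declaration of `x` from `Γ` -/
def eraseG (Γ : List (ℕ × β)) (x : ℕ) : List (ℕ × β) :=
  Γ.filter (fun p => !(p.1 == x))

/-- `Γ[y/x]` : rename the declared variable `x` to `y` -/
def renG (Γ : List (ℕ × β)) (x y : ℕ) : List (ℕ × β) :=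
  Γ.map (fun p => (if p.1 = x then y else p.1, p.2))

/-- `Γ[y₁/x₁, …, yₙ/xₙ]` -/
def renListG (Γ : List (ℕ × β)) (xs ys : List ℕ) : List (ℕ × β) :=
  (xs.zip ys).foldl (fun Δ q => renG Δ q.1 q.2) Γ

end GEnv

/-- environments of the Linear Rank 2 Intersection Type System
(also called `T¹_L`-environments) -/
abbrev Env := List (ℕ × Multiset LTy)

/-- applying a type substitution to an environment -/
def envApplyS (S : TSub) (Γ : Env) : Env :=
  Γ.map (fun p => (p.1, p.2.map (LTy.applyS S)))

/-- the type variables occurring in an environment -/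
def envTv (Γ : Env) : Finset ℕ :=
  Γ.foldr (fun p acc => (p.2.map LTy.tv).sup ∪ acc) ∅

/-- the type variables occurring in a pair (environment, type) -/
def tvOf (Γ : Env) (σ : Ty2) : Finset ℕ := envTv Γ ∪ σ.tv

/-! ## The Linear Rank 2 Intersection Type System (with depth-indexed derivations) -/

/-- `DerN d Γ M σ`: there is a derivation of depth `d` of `Γ ⊢₂ M : σ`. -/
inductive DerN : ℕ → Env → Term → Ty2 → Prop
  | ax (x : ℕ) (τ : LTy) :
      DerN 0 [(x, {τ})] (.var x) (.lin τ)
  | exch (d : ℕ) (Γ₁ Γ₂ : Env) (x y : ℕ) (A B : Multiset LTy) (M : Term) (σ : Ty2) :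
      DerN d (Γ₁ ++ (x, A) :: (y, B) :: Γ₂) M σ →
      DerN (d + 1) (Γ₁ ++ (y, B) :: (x, A) :: Γ₂) M σ
  | contr (d : ℕ) (Γ₁ Γ₂ : Env) (x₁ x₂ x : ℕ) (A B : Multiset LTy) (M : Term) (σ : Ty2) :
      DerN d (Γ₁ ++ (x₁, A) :: (x₂, B) :: Γ₂) M σ →
      x ∉ domG (Γ₁ ++ Γ₂) →
      DerN (d + 1) (Γ₁ ++ (x, A + B) :: Γ₂) ((M.subst x₁ (.var x)).subst x₂ (.var x)) σ
  | introArrow (d : ℕ) (Γ : Env) (x : ℕ) (A : Multiset LTy) (M : Term) (σ : Ty2) :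
      DerN d (Γ ++ [(x, A)]) M σ →
      2 ≤ Multiset.card A →
      DerN (d + 1) Γ (.lam x M) (.arrow A σ)
  | introLolly (d : ℕ) (Γ : Env) (x : ℕ) (τ : LTy) (M : Term) (σ : Ty2) :
      DerN d (Γ ++ [(x, ({τ} : Multiset LTy))]) M σ →
      DerN (d + 1) Γ (.lam x M) (Ty2.mkLolly τ σ)
  | elimLolly (d₁ d₂ : ℕ) (Γ₁ Γ₂ : Env) (M₁ M₂ : Term) (τ : LTy) (σ : Ty2) :
      DerN d₁ Γ₁ M₁ (Ty2.mkLolly τ σ) →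
      DerN d₂ Γ₂ M₂ (.lin τ) →
      consistentG (Γ₁ ++ Γ₂) →
      DerN (max d₁ d₂ + 1) (Γ₁ ++ Γ₂) (.app M₁ M₂) σ
  | elimArrow (d : ℕ) (Γ : Env) (M₁ M₂ : Term) (σ : Ty2) (l : List (ℕ × Env × LTy)) :
      DerN d Γ M₁ (.arrow (Multiset.ofList (l.map (fun p => p.2.2))) σ) →
      (∀ p ∈ l, DerN p.1 p.2.1 M₂ (.lin p.2.2)) →
      2 ≤ l.length →
      consistentG (Γ ++ sumG (l.map (fun p => p.2.1))) →
      DerN (max d ((l.map Prod.fst).foldr max 0) + 1)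
        (Γ ++ sumG (l.map (fun p => p.2.1))) (.app M₁ M₂) σ

/-- `Γ ⊢₂ M : σ` in the Linear Rank 2 Intersection Type System. -/
def Der (Γ : Env) (M : Term) (σ : Ty2) : Prop := ∃ d, DerN d Γ M σ

/-! ## Unification and the type inference algorithm -/

/-- `S` unifies all the equations of `P` -/
def Unifies (S : TSub) (P : List (LTy × LTy)) : Prop :=
  ∀ e ∈ P, LTy.applyS S e.1 = LTy.applyS S e.2

/-- `S` is a most general unifier of `P` -/
def IsMGU (S : TSub) (P : List (LTy × LTy)) : Prop :=
  Unifies S P ∧ ∀ S' : TSub, Unifies S' P →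
    ∃ S'' : TSub, ∀ α, S' α = LTy.applyS S'' (S α)

/-- `Infer M Γ σ` : the type inference algorithm, run on `M`, may return `(Γ, σ)`
(fresh type variables are modelled by disjointness side conditions). -/
inductive Infer : Term → Env → Ty2 → Prop
  | var (x α : ℕ) :
      Infer (.var x) [(x, {LTy.var α})] (.lin (.var α))
  | lamLolly {M₁ : Term} {Γ₁ : Env} {σ₁ : Ty2} (x : ℕ) (τ : LTy) :
      Infer M₁ Γ₁ σ₁ →
      (x, ({τ} : Multiset LTy)) ∈ Γ₁ →
      Infer (.lam x M₁) (eraseG Γ₁ x) (Ty2.mkLolly τ σ₁)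
  | lamArrow {M₁ : Term} {Γ₁ : Env} {σ₁ : Ty2} (x : ℕ) (A : Multiset LTy) :
      Infer M₁ Γ₁ σ₁ →
      (x, A) ∈ Γ₁ →
      2 ≤ Multiset.card A →
      Infer (.lam x M₁) (eraseG Γ₁ x) (.arrow A σ₁)
  | appVar {M₁ M₂ : Term} {Γ₁ Γ₂ : Env} (α₁ : ℕ) (τ₂ : LTy) (α₂ α₃ : ℕ) (S : TSub) :
      Infer M₁ Γ₁ (.lin (.var α₁)) →
      Infer M₂ Γ₂ (.lin τ₂) →
      Disjoint (tvOf Γ₁ (.lin (.var α₁))) (tvOf Γ₂ (.lin τ₂)) →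
      α₂ ∉ tvOf Γ₁ (.lin (.var α₁)) ∪ tvOf Γ₂ (.lin τ₂) →
      α₃ ∉ tvOf Γ₁ (.lin (.var α₁)) ∪ tvOf Γ₂ (.lin τ₂) →
      α₂ ≠ α₃ →
      IsMGU S [(LTy.var α₁, LTy.lolly (.var α₂) (.var α₃)), (τ₂, LTy.var α₂)] →
      Infer (.app M₁ M₂) (envApplyS S (addG Γ₁ Γ₂)) (.lin (S α₃))
  | appArrow {M₁ M₂ : Term} {Γ₁ : Env} {σ₁ : Ty2}
      (l : List (Env × LTy)) (ts : List LTy) (S : TSub) :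
      Infer M₁ Γ₁ (.arrow (Multiset.ofList ts) σ₁) →
      (∀ p ∈ l, Infer M₂ p.1 (.lin p.2)) →
      l.length = ts.length →
      2 ≤ l.length →
      List.Pairwise (fun p q => Disjoint (tvOf p.1 (.lin p.2)) (tvOf q.1 (.lin q.2))) l →
      (∀ p ∈ l, Disjoint (tvOf Γ₁ (.arrow (Multiset.ofList ts) σ₁)) (tvOf p.1 (.lin p.2))) →
      IsMGU S ((l.map Prod.snd).zip ts) →
      Infer (.app M₁ M₂) (envApplyS S (addG Γ₁ (sumG (l.map Prod.fst)))) (Ty2.applyS S σ₁)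
  | appLolly {M₁ M₂ : Term} {Γ₁ Γ₂ : Env} (τ : LTy) (σ₁ : Ty2) (τ₂ : LTy) (S : TSub) :
      Infer M₁ Γ₁ (Ty2.mkLolly τ σ₁) →
      Infer M₂ Γ₂ (.lin τ₂) →
      Disjoint (tvOf Γ₁ (Ty2.mkLolly τ σ₁)) (tvOf Γ₂ (.lin τ₂)) →
      IsMGU S [(τ₂, τ)] →
      Infer (.app M₁ M₂) (envApplyS S (addG Γ₁ Γ₂)) (Ty2.applyS S σ₁)

/-! ## Multi-types and the Linear Rank 2 Quantitative Type System -/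

/-- rank 0 multi-types: `t ::= Neutral | Abs | α | t ⊸ t` -/
inductive MTy : Type
  | Neutral : MTy
  | Abs : MTy
  | var : ℕ → MTy
  | lolly : MTy → MTy → MTy

/-- rank 2 multi-types (rank 1 multi-types are multisets of rank 0 multi-types) -/
inductive MTy2 : Type
  | base : MTy → MTy2
  | lolly : MTy → MTy2 → MTy2
  | arrow : Multiset MTy → MTy2 → MTy2

/-- `t ⊸ s`, identifying `t ⊸ t'` with the rank 0 multi-type `t ⊸ t'` -/
def MTy2.mkLolly (t : MTy) : MTy2 → MTy2
  | .base t' => .base (.lolly t t')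
  | s => .lolly t s

/-- a rank 0 multi-type is tight iff it is one of the tight constants -/
def MTy.tight (t : MTy) : Prop := t = .Neutral ∨ t = .Abs

/-- a rank 1 multi-type is tight iff all its components are -/
def tightSeq (ts : Multiset MTy) : Prop := ∀ t ∈ ts, MTy.tight t

/-- a rank 2 multi-type is tight iff it is a tight constant -/
def MTy2.tight (s : MTy2) : Prop := s = .base .Neutral ∨ s = .base .Abs

/-- environments of the quantitative system: each declaration carries a pair
(sequence of linear types, rank 1 multi-type) -/
abbrev QEnv := List (ℕ × (Multiset LTy × Multiset MTy))

/-- a quantitative environment is tight iff all its multi-type components are -/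
def tightE (Γ : QEnv) : Prop := ∀ p ∈ Γ, tightSeq p.2.2

/-- the Linear Rank 2 Quantitative Type System: `QDer Γ b M σ s` is
`Γ ⊢^b M : σ | s`. -/
inductive QDer : QEnv → ℕ → Term → Ty2 → MTy2 → Prop
  | ax (x : ℕ) (τ : LTy) (t : MTy) :
      QDer [(x, ({τ}, {t}))] 0 (.var x) (.lin τ) (.base t)
  | exch (Γ₁ Γ₂ : QEnv) (x y : ℕ) (A B : Multiset LTy × Multiset MTy)
      (b : ℕ) (M : Term) (σ : Ty2) (s : MTy2) :
      QDer (Γ₁ ++ (x, A) :: (y, B) :: Γ₂) b M σ s →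
      QDer (Γ₁ ++ (y, B) :: (x, A) :: Γ₂) b M σ s
  | contr (Γ₁ Γ₂ : QEnv) (x₁ x₂ x : ℕ) (A₁ A₂ : Multiset LTy × Multiset MTy)
      (b : ℕ) (M : Term) (σ : Ty2) (s : MTy2) :
      QDer (Γ₁ ++ (x₁, A₁) :: (x₂, A₂) :: Γ₂) b M σ s →
      x ∉ domG (Γ₁ ++ Γ₂) →
      QDer (Γ₁ ++ (x, A₁ + A₂) :: Γ₂) b ((M.subst x₁ (.var x)).subst x₂ (.var x)) σ s
  | introLolly (Γ : QEnv) (x : ℕ) (τ : LTy) (t : MTy) (b : ℕ) (M : Term) (σ : Ty2) (s : MTy2) :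
      QDer (Γ ++ [(x, ({τ}, {t}))]) b M σ s →
      QDer Γ (b + 1) (.lam x M) (Ty2.mkLolly τ σ) (MTy2.mkLolly t s)
  | introLollyT (Γ : QEnv) (x : ℕ) (τ : LTy) (t : MTy) (b : ℕ) (M : Term) (σ : Ty2) (s : MTy2) :
      QDer (Γ ++ [(x, ({τ}, {t}))]) b M σ s →
      MTy.tight t →
      MTy2.tight s →
      QDer Γ b (.lam x M) (Ty2.mkLolly τ σ) (.base .Abs)
  | introArrow (Γ : QEnv) (x : ℕ) (A : Multiset LTy) (ts : Multiset MTy)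
      (b : ℕ) (M : Term) (σ : Ty2) (s : MTy2) :
      QDer (Γ ++ [(x, (A, ts))]) b M σ s →
      2 ≤ Multiset.card A →
      Multiset.card ts = Multiset.card A →
      QDer Γ (b + 1) (.lam x M) (.arrow A σ) (.arrow ts s)
  | introArrowT (Γ : QEnv) (x : ℕ) (A : Multiset LTy) (ts : Multiset MTy)
      (b : ℕ) (M : Term) (σ : Ty2) (s : MTy2) :
      QDer (Γ ++ [(x, (A, ts))]) b M σ s →
      2 ≤ Multiset.card A →
      tightSeq ts →
      MTy2.tight s →
      QDer Γ b (.lam x M) (.arrow A σ) (.base .Abs)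
  | elimLolly (Γ₁ Γ₂ : QEnv) (b₁ b₂ : ℕ) (M₁ M₂ : Term) (τ : LTy) (σ : Ty2) (t : MTy) (s : MTy2) :
      QDer Γ₁ b₁ M₁ (Ty2.mkLolly τ σ) (MTy2.mkLolly t s) →
      QDer Γ₂ b₂ M₂ (.lin τ) (.base t) →
      consistentG (Γ₁ ++ Γ₂) →
      QDer (Γ₁ ++ Γ₂) (b₁ + b₂) (.app M₁ M₂) σ s
  | elimLollyT (Γ₁ Γ₂ : QEnv) (b₁ b₂ : ℕ) (M₁ M₂ : Term) (τ : LTy) (σ : Ty2) (s₂ : MTy2) :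
      QDer Γ₁ b₁ M₁ (Ty2.mkLolly τ σ) (.base .Neutral) →
      QDer Γ₂ b₂ M₂ (.lin τ) s₂ →
      MTy2.tight s₂ →
      consistentG (Γ₁ ++ Γ₂) →
      QDer (Γ₁ ++ Γ₂) (b₁ + b₂) (.app M₁ M₂) σ (.base .Neutral)
  | elimArrow (Γ : QEnv) (b : ℕ) (M₁ M₂ : Term) (σ : Ty2) (s : MTy2)
      (l : List (QEnv × ℕ × LTy × MTy)) :
      QDer Γ b M₁ (.arrow (Multiset.ofList (l.map (fun p => p.2.2.1))) σ)
        (.arrow (Multiset.ofList (l.map (fun p => p.2.2.2))) s) →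
      (∀ p ∈ l, QDer p.1 p.2.1 M₂ (.lin p.2.2.1) (.base p.2.2.2)) →
      2 ≤ l.length →
      consistentG (Γ ++ sumG (l.map Prod.fst)) →
      QDer (Γ ++ sumG (l.map Prod.fst)) (b + (l.map (fun p => p.2.1)).sum) (.app M₁ M₂) σ s
  | elimArrowT (Γ : QEnv) (b : ℕ) (M₁ M₂ : Term) (σ : Ty2)
      (l : List (QEnv × ℕ × LTy × MTy2)) :
      QDer Γ b M₁ (.arrow (Multiset.ofList (l.map (fun p => p.2.2.1))) σ) (.base .Neutral) →
      (∀ p ∈ l, QDer p.1 p.2.1 M₂ (.lin p.2.2.1) p.2.2.2) →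
      (∀ p ∈ l, MTy2.tight p.2.2.2) →
      2 ≤ l.length →
      consistentG (Γ ++ sumG (l.map Prod.fst)) →
      QDer (Γ ++ sumG (l.map Prod.fst)) (b + (l.map (fun p => p.2.1)).sum)
        (.app M₁ M₂) σ (.base .Neutral)

/-! ## Leftmost-outermost normal forms and evaluation -/

namespace Term

mutual
  /-- leftmost-outermost neutral terms -/
  inductive Neutral : Term → Prop
    | var (x : ℕ) : Neutral (.var x)
    | app {M N : Term} : Neutral M → Normal N → Neutral (.app M N)
  /-- leftmost-outermost normal terms -/
  inductive Normal : Term → Prop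
    | of_neutral {M : Term} : Neutral M → Normal M
    | lam (x : ℕ) {M : Term} : Normal M → Normal (.lam x M)
end

/-- one step of the leftmost-outermost evaluation strategy -/
inductive Step : Term → Term → Prop
  | beta (x : ℕ) (M N : Term) : Step (.app (.lam x M) N) (M.subst x N)
  | lam (x : ℕ) {M M' : Term} : Step M M' → Step (.lam x M) (.lam x M')
  | appL {M M' N : Term} : Step M M' → ¬ IsAbs M → Step (.app M N) (.app M' N)
  | appR {N M M' : Term} : Neutral N → Step M M' → Step (.app N M) (.app N M')

/-- `StepsN b M N` : `M ⟶^b N`, i.e. `M` reduces to `N` in exactly `b`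
leftmost-outermost steps -/
inductive StepsN : ℕ → Term → Term → Prop
  | refl (M : Term) : StepsN 0 M M
  | step {M M' N : Term} {b : ℕ} : Step M M' → StepsN b M' N → StepsN (b + 1) M N

end Term

/-! ## Quantitative unification and the quantitative type inference algorithm -/

/-- `[τ/α]` applied to a linear type -/
def substVar (τ : LTy) (α : ℕ) : LTy → LTy
  | .var β => if β = α then τ else .var β
  | .lolly a b => .lolly (substVar τ α a) (substVar τ α b)

/-- `[τ/α]` applied to a unification problem -/
def substEqs (τ : LTy) (α : ℕ) (P : Multiset (LTy × LTy)) : Multiset (LTy × LTy) :=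
  P.map (fun e => (substVar τ α e.1, substVar τ α e.2))

/-- `α` occurs in the unification problem `P` -/
def occursIn (α : ℕ) (P : Multiset (LTy × LTy)) : Prop :=
  ∃ e ∈ P, α ∈ e.1.tv ∨ α ∈ e.2.tv

/-- one transformation step `P ⇒ P'` on unification problems; the third component
is `1` for a decomposition step `{τ₁ ⊸ τ₂ = τ₃ ⊸ τ₄} ∪ P ⇒ {τ₁ = τ₃, τ₂ = τ₄} ∪ P`
and `0` otherwise -/
inductive UStep : Multiset (LTy × LTy) → Multiset (LTy × LTy) → ℕ → Prop
  | del (τ : LTy) (P : Multiset (LTy × LTy)) :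
      UStep ((τ, τ) ::ₘ P) P 0
  | dec (a b c d : LTy) (P : Multiset (LTy × LTy)) :
      UStep ((LTy.lolly a b, LTy.lolly c d) ::ₘ P) ((a, c) ::ₘ (b, d) ::ₘ P) 1
  | swap (a b : LTy) (α : ℕ) (P : Multiset (LTy × LTy)) :
      UStep ((LTy.lolly a b, LTy.var α) ::ₘ P) ((LTy.var α, LTy.lolly a b) ::ₘ P) 0
  | elim (α : ℕ) (τ : LTy) (P : Multiset (LTy × LTy)) :
      occursIn α P →
      α ∉ τ.tv →
      UStep ((LTy.var α, τ) ::ₘ P) ((LTy.var α, τ) ::ₘ substEqs τ α P) 0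

/-- iterated transformation steps, accumulating the number of decompositions -/
inductive URun : Multiset (LTy × LTy) → Multiset (LTy × LTy) → ℕ → Prop
  | refl (P : Multiset (LTy × LTy)) : URun P P 0
  | step {P Q R : Multiset (LTy × LTy)} {k b : ℕ} :
      UStep P Q k → URun Q R b → URun P R (k + b)

/-- `P` is in solved form, inducing the substitution `S` -/
def SolvedWith (P : Multiset (LTy × LTy)) (S : TSub) : Prop :=
  ∃ L : List (ℕ × LTy),
    Multiset.ofList (L.map (fun p => (LTy.var p.1, p.2))) = P ∧
    (L.map Prod.fst).Nodup ∧
    (∀ p ∈ L, ∀ q ∈ L, p.1 ∉ q.2.tv) ∧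
    S = fun β => (((L.find? (fun p => p.1 == β)).map Prod.snd).getD (LTy.var β))

/-- `UNIFY_Q(P) = (S, b)`: the quantitative unification algorithm succeeds on `P`
returning the most general unifier `S` and the number `b` of decomposition steps -/
def UnifyQ (P : Multiset (LTy × LTy)) (S : TSub) (b : ℕ) : Prop :=
  ∃ P', URun P P' b ∧ (∀ Q k, ¬ UStep P' Q k) ∧ SolvedWith P' S

/-- `QInfer M Γ σ b` : the quantitative type inference algorithm `T_Q`, run on
`M`, may return `(Γ, σ, b)`. -/
inductive QInfer : Term → Env → Ty2 → ℕ → Prop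
  | var (x α : ℕ) :
      QInfer (.var x) [(x, {LTy.var α})] (.lin (.var α)) 0
  | lamLolly {M₁ : Term} {Γ₁ : Env} {σ₁ : Ty2} {b₁ : ℕ} (x : ℕ) (τ : LTy) :
      QInfer M₁ Γ₁ σ₁ b₁ →
      (x, ({τ} : Multiset LTy)) ∈ Γ₁ →
      QInfer (.lam x M₁) (eraseG Γ₁ x) (Ty2.mkLolly τ σ₁) b₁
  | lamArrow {M₁ : Term} {Γ₁ : Env} {σ₁ : Ty2} {b₁ : ℕ} (x : ℕ) (A : Multiset LTy) :
      QInfer M₁ Γ₁ σ₁ b₁ →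
      (x, A) ∈ Γ₁ →
      2 ≤ Multiset.card A →
      QInfer (.lam x M₁) (eraseG Γ₁ x) (.arrow A σ₁) b₁
  | appVar {M₁ M₂ : Term} {Γ₁ Γ₂ : Env} {b₁ b₂ : ℕ}
      (α₁ : ℕ) (τ₂ : LTy) (α₂ α₃ : ℕ) (S : TSub) (bu : ℕ) :
      QInfer M₁ Γ₁ (.lin (.var α₁)) b₁ →
      QInfer M₂ Γ₂ (.lin τ₂) b₂ →
      Disjoint (tvOf Γ₁ (.lin (.var α₁))) (tvOf Γ₂ (.lin τ₂)) →
      α₂ ∉ tvOf Γ₁ (.lin (.var α₁)) ∪ tvOf Γ₂ (.lin τ₂) →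
      α₃ ∉ tvOf Γ₁ (.lin (.var α₁)) ∪ tvOf Γ₂ (.lin τ₂) →
      α₂ ≠ α₃ →
      UnifyQ {(LTy.var α₁, LTy.lolly (.var α₂) (.var α₃)), (τ₂, LTy.var α₂)} S bu →
      QInfer (.app M₁ M₂) (envApplyS S (addG Γ₁ Γ₂)) (.lin (S α₃)) (b₁ + b₂)
  | appArrow {M₁ M₂ : Term} {Γ₁ : Env} {σ₁ : Ty2} {b₁ : ℕ}
      (l : List (Env × LTy × ℕ)) (ts : List LTy) (S : TSub) (bu : ℕ) :
      QInfer M₁ Γ₁ (.arrow (Multiset.ofList ts) σ₁) b₁ →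
      (∀ p ∈ l, QInfer M₂ p.1 (.lin p.2.1) p.2.2) →
      l.length = ts.length →
      2 ≤ l.length →
      List.Pairwise (fun p q => Disjoint (tvOf p.1 (.lin p.2.1)) (tvOf q.1 (.lin q.2.1))) l →
      (∀ p ∈ l, Disjoint (tvOf Γ₁ (.arrow (Multiset.ofList ts) σ₁)) (tvOf p.1 (.lin p.2.1))) →
      UnifyQ (Multiset.ofList ((l.map (fun p => p.2.1)).zip ts)) S bu →
      QInfer (.app M₁ M₂) (envApplyS S (addG Γ₁ (sumG (l.map Prod.fst)))) (Ty2.applyS S σ₁)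
        (b₁ + (l.map (fun p => p.2.2)).sum + bu + 1)
  | appLolly {M₁ M₂ : Term} {Γ₁ Γ₂ : Env} {b₁ b₂ : ℕ}
      (τ : LTy) (σ₁ : Ty2) (τ₂ : LTy) (S : TSub) (bu : ℕ) :
      QInfer M₁ Γ₁ (Ty2.mkLolly τ σ₁) b₁ →
      QInfer M₂ Γ₂ (.lin τ₂) b₂ →
      Disjoint (tvOf Γ₁ (Ty2.mkLolly τ σ₁)) (tvOf Γ₂ (.lin τ₂)) →
      UnifyQ {(τ₂, τ)} S bu →
      QInfer (.app M₁ M₂) (envApplyS S (addG Γ₁ Γ₂)) (Ty2.applyS S σ₁) (b₁ + b₂ + bu + 1)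

section Renaming

variable {β : Type}

theorem mem_domG_addG [Zero β] [Add β] {Γ₁ Γ₂ : List (ℕ × β)} {z : ℕ} :
    z ∈ domG (addG Γ₁ Γ₂) ↔ z ∈ domG Γ₁ ∨ z ∈ domG Γ₂ := by
  simp only [domG, addG, List.map_append, List.map_map, List.mem_append, List.mem_map,
    List.mem_filter, Function.comp]
  constructor
  · rintro (⟨p, hp, rfl⟩ | ⟨p, ⟨hp, -⟩, rfl⟩)
    · exact .inl ⟨p, hp, rfl⟩
    · exact .inr ⟨p, hp, rfl⟩
  · rintro (⟨p, hp, rfl⟩ | ⟨p, hp, rfl⟩)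
    · exact .inl ⟨p, hp, rfl⟩
    · by_cases h : p.1 ∈ Γ₁.map Prod.fst
      · obtain ⟨q, hq, e⟩ := List.mem_map.1 h
        exact .inl ⟨q, hq, e⟩
      · exact .inr ⟨p, ⟨hp, by simpa using h⟩, rfl⟩

theorem mem_domG_sumG [Zero β] [Add β] {l : List (List (ℕ × β))} {z : ℕ} :
    z ∈ domG (sumG l) ↔ ∃ Γ ∈ l, z ∈ domG Γ := by
  induction l with
  | nil => simp [sumG, domG]
  | cons Γ l ih =>
    have h : sumG (Γ :: l) = addG Γ (sumG l) := rfl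
    simp [h, mem_domG_addG, ih]

theorem domG_envApplyS (S : TSub) (Γ : Env) : domG (envApplyS S Γ) = domG Γ := by
  simp [domG, envApplyS]

theorem mem_domG_of_mem_eraseG {Γ : List (ℕ × β)} {x z : ℕ} (h : z ∈ domG (eraseG Γ x)) :
    z ∈ domG Γ := by
  simp only [domG, eraseG, List.mem_map, List.mem_filter] at h ⊢
  obtain ⟨p, ⟨hp, -⟩, rfl⟩ := h
  exact ⟨p, hp, rfl⟩

theorem lookupG_renG [Zero β] {Γ : List (ℕ × β)} {x y z : ℕ} (hΓ : y ∉ domG Γ) (hz : z ≠ y) :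
    lookupG (renG Γ x y) (if z = x then y else z) = lookupG Γ z := by
  induction Γ with
  | nil => rfl
  | cons p Γ ih =>
    simp only [domG, List.map_cons, List.mem_cons, not_or] at hΓ
    have ih := ih hΓ.2
    simp only [lookupG, renG, List.map_cons, List.find?_cons] at ih ⊢
    by_cases h : p.1 = z
    · simp [h]
    · have h' : (if p.1 = x then y else p.1) ≠ (if z = x then y else z) := by
        have := hΓ.1
        split_ifs <;> grind
      rw [beq_false_of_ne h, beq_false_of_ne h']
      exact ih

theorem contains_domG_renG {Γ : List (ℕ × β)} {x y z : ℕ} (hΓ : y ∉ domG Γ) (hz : z ≠ y) :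
    ((renG Γ x y).map Prod.fst).contains (if z = x then y else z) =
      (Γ.map Prod.fst).contains z := by
  rw [Bool.eq_iff_iff]
  simp only [domG, renG, List.contains_iff_mem, List.map_map, List.mem_map, Function.comp] at hΓ ⊢
  refine exists_congr fun p => and_congr_right fun hp => ?_
  have : p.1 ≠ y := fun e => hΓ ⟨p, hp, e⟩
  split_ifs <;> grind

theorem renG_addG [Zero β] [Add β] {Γ₁ Γ₂ : List (ℕ × β)} {x y : ℕ}
    (h₁ : y ∉ domG Γ₁) (h₂ : y ∉ domG Γ₂) :
    renG (addG Γ₁ Γ₂) x y = addG (renG Γ₁ x y) (renG Γ₂ x y) := by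
  have ne : ∀ {Γ : List (ℕ × β)}, y ∉ domG Γ → ∀ p ∈ Γ, p.1 ≠ y :=
    fun h p hp e => h (List.mem_map.2 ⟨p, hp, e⟩)
  unfold addG
  rw [renG, List.map_append]
  congr 1
  · conv_rhs => rw [renG.eq_def Γ₁]
    rw [List.map_map, List.map_map]
    refine List.map_congr_left fun p hp => ?_
    simp only [Function.comp]
    rw [lookupG_renG h₂ (ne h₁ p hp)]
  · conv_rhs => rw [renG.eq_def Γ₂, List.filter_map]
    congr 1
    refine List.filter_congr fun p hp => ?_
    simp only [Function.comp]
    rw [contains_domG_renG h₁ (ne h₂ p hp)]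

theorem renG_sumG [Zero β] [Add β] {l : List (List (ℕ × β))} {x y : ℕ}
    (h : ∀ Γ ∈ l, y ∉ domG Γ) :
    renG (sumG l) x y = sumG (l.map fun Γ => renG Γ x y) := by
  induction l with
  | nil => rfl
  | cons Γ l ih =>
    rw [List.forall_mem_cons] at h
    have hs : y ∉ domG (sumG l) := by
      rw [mem_domG_sumG]
      rintro ⟨Δ, hΔ, hy⟩
      exact h.2 Δ hΔ hy
    change renG (addG Γ (sumG l)) x y = addG (renG Γ x y) (sumG (l.map fun Γ => renG Γ x y))
    rw [renG_addG h.1 hs, ih h.2]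

theorem renG_envApplyS (S : TSub) (Γ : Env) (x y : ℕ) :
    renG (envApplyS S Γ) x y = envApplyS S (renG Γ x y) := by
  simp [renG, envApplyS]

theorem tvOf_renG (Γ : Env) (σ : Ty2) (x y : ℕ) : tvOf (renG Γ x y) σ = tvOf Γ σ := by
  simp [tvOf, envTv, renG, List.foldr_map]

theorem eraseG_renG {Γ : List (ℕ × β)} {x y z : ℕ} (hx : z ≠ x) (hy : z ≠ y) :
    eraseG (renG Γ x y) z = renG (eraseG Γ z) x y := by
  rw [eraseG, renG, List.filter_map, eraseG, renG]
  congr 1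
  refine List.filter_congr fun p _ => ?_
  simp only [Function.comp]
  congr 1
  rw [Bool.eq_iff_iff]
  simp only [beq_iff_eq]
  split_ifs <;> grind

theorem renG_eraseG_self (Γ : List (ℕ × β)) (x y : ℕ) :
    renG (eraseG Γ x) x y = eraseG Γ x := by
  refine (List.map_congr_left fun p hp => ?_).trans (List.map_id _)
  have : p.1 ≠ x := by simpa using (List.mem_filter.1 hp).2
  simp [this]

theorem mem_renG {Γ : List (ℕ × β)} {x y z : ℕ} {b : β} (hz : z ≠ x) (h : (z, b) ∈ Γ) :
    (z, b) ∈ renG Γ x y :=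
  List.mem_map.2 ⟨(z, b), h, by simp [hz]⟩

end Renaming

theorem Infer.mem_allVars {M : Term} {Γ : Env} {σ : Ty2} (h : Infer M Γ σ) {z : ℕ}
    (hz : z ∈ domG Γ) : z ∈ M.allVars := by
  induction h with
  | var x α => simpa [domG, Term.allVars] using hz
  | lamLolly x τ _ _ ih =>
    exact Finset.mem_insert_of_mem (ih (mem_domG_of_mem_eraseG hz))
  | lamArrow x A _ _ _ ih =>
    exact Finset.mem_insert_of_mem (ih (mem_domG_of_mem_eraseG hz))
  | appVar α₁ τ₂ α₂ α₃ S _ _ _ _ _ _ _ ih₁ ih₂ =>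
    rw [domG_envApplyS, mem_domG_addG] at hz
    exact Finset.mem_union.2 (hz.imp ih₁ ih₂)
  | appArrow l ts S _ _ _ _ _ _ _ ih₁ ih₂ =>
    rw [domG_envApplyS, mem_domG_addG, mem_domG_sumG] at hz
    refine Finset.mem_union.2 (hz.imp ih₁ ?_)
    rintro ⟨Γ, hΓ, hz⟩
    obtain ⟨p, hp, rfl⟩ := List.mem_map.1 hΓ
    exact ih₂ p hp hz
  | appLolly τ σ₁ τ₂ S _ _ _ _ ih₁ ih₂ =>
    rw [domG_envApplyS, mem_domG_addG] at hz
    exact Finset.mem_union.2 (hz.imp ih₁ ih₂)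

/-- Renaming `x` to a fresh `y` preserves type inference, whether or not `x` occurs free. -/
theorem Infer.rename {M : Term} {Γ : Env} {σ : Ty2} (h : Infer M Γ σ) (x : ℕ) {y : ℕ}
    (hy : y ∉ M.allVars) : Infer (M.subst x (.var y)) (renG Γ x y) σ := by
  induction h with
  | var z α =>
    by_cases hz : z = x
    · simpa [Term.subst, renG, hz] using Infer.var y α
    · simpa [Term.subst, renG, hz] using Infer.var z α
  | lamLolly z τ h hm ih =>
    simp only [Term.allVars, Finset.mem_insert, not_or] at hy
    by_cases hz : z = x
    · subst hz
      simpa [Term.subst, renG_eraseG_self] using Infer.lamLolly z τ h hm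
    · simpa [Term.subst, hz, eraseG_renG hz (Ne.symm hy.1)] using
        Infer.lamLolly z τ (ih hy.2) (mem_renG hz hm)
  | lamArrow z A h hm hA ih =>
    simp only [Term.allVars, Finset.mem_insert, not_or] at hy
    by_cases hz : z = x
    · subst hz
      simpa [Term.subst, renG_eraseG_self] using Infer.lamArrow z A h hm hA
    · simpa [Term.subst, hz, eraseG_renG hz (Ne.symm hy.1)] using
        Infer.lamArrow z A (ih hy.2) (mem_renG hz hm) hA
  | appVar α₁ τ₂ α₂ α₃ S h₁ h₂ hd h2 h3 hne hS ih₁ ih₂ =>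
    simp only [Term.allVars, Finset.mem_union, not_or] at hy
    rw [renG_envApplyS, renG_addG (mt h₁.mem_allVars hy.1) (mt h₂.mem_allVars hy.2)]
    refine .appVar α₁ τ₂ α₂ α₃ S (ih₁ hy.1) (ih₂ hy.2) ?_ ?_ ?_ hne hS <;>
      simpa only [tvOf_renG]
  | appArrow l ts S h₁ h₂ hlen h2 hp hd hS ih₁ ih₂ =>
    simp only [Term.allVars, Finset.mem_union, not_or] at hy
    have hl : ∀ Δ ∈ l.map Prod.fst, y ∉ domG Δ := by
      intro Δ hΔ
      obtain ⟨p, hp, rfl⟩ := List.mem_map.1 hΔ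
      exact mt (h₂ p hp).mem_allVars hy.2
    have hs : y ∉ domG (sumG (l.map Prod.fst)) := by
      rw [mem_domG_sumG]
      rintro ⟨Δ, hΔ, h⟩
      exact hl Δ hΔ h
    rw [renG_envApplyS, renG_addG (mt h₁.mem_allVars hy.1) hs, renG_sumG hl]
    have key := Infer.appArrow (M₂ := Term.subst _ x (.var y))
      (l.map fun p => (renG p.1 x y, p.2)) ts S (ih₁ hy.1)
      (List.forall_mem_map.2 fun p hp => ih₂ p hp hy.2) (by simpa using hlen) (by simpa using h2)
      (List.pairwise_map.2 (by simpa only [tvOf_renG] using hp))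
      (List.forall_mem_map.2 (by simpa only [tvOf_renG] using hd))
      (by simpa [Function.comp_def] using hS)
    simpa [Term.subst, Function.comp_def] using key
  | appLolly τ σ₁ τ₂ S h₁ h₂ hd hS ih₁ ih₂ =>
    simp only [Term.allVars, Finset.mem_union, not_or] at hy
    rw [renG_envApplyS, renG_addG (mt h₁.mem_allVars hy.1) (mt h₂.mem_allVars hy.2)]
    refine .appLolly τ σ₁ τ₂ S (ih₁ hy.1) (ih₂ hy.2) ?_ hS
    simpa only [tvOf_renG]

/-- If `T(M) = (Γ, σ)`, `x` occurs free in `M` and `y` does not occur in `M`,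
then `T(M[y/x]) = (Γ[y/x], σ)` (types up to renaming of type variables,
which is built into the relational presentation of the algorithm). -/
theorem infer_rename (M : Term) (Γ : Env) (σ : Ty2) (x y : ℕ)
    (h : Infer M Γ σ) (hx : x ∈ M.fv) (hy : y ∉ M.allVars) :
    Infer (M.subst x (.var y)) (renG Γ x y) σ := by
  exact h.rename x hy
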